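/- There is no integer d and 10×10 integer matrix M with nonzero determinant such that M·G₀·Mᵀ equals the block-diagonal matrix diag(d) ⊕ (−C), where C is the block Cartan matrix of D₄ ⊕ A₄ ⊕ A₁. Equivalently, no rank-10 lattice of the form ℤH ⊥ R with R the negative-definite root lattice D₄ + A₄ + A₁ embeds as a finite-index sublattice of the even unimodular lattice U + E₈ of signature (1,9). (This is the lattice-theoretic content of the paper's exclusion of the root type D₄ + A₄ + A₁, whose discriminant group has length 3.) -/

import Mathlib

open Matrix

/-- The Cartan matrix of the root lattice `Aₙ`: vertices `0, …, n-1` in a chain. -/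
def cartanA (n : ℕ) : Matrix (Fin n) (Fin n) ℤ :=
  Matrix.of fun i j =>
    if i = j then 2
    else if (i : ℕ) + 1 = (j : ℕ) ∨ (j : ℕ) + 1 = (i : ℕ) then -1
    else 0

/-- The Cartan matrix of the root lattice `Dₙ` (`n ≥ 4`): a chain `0 — 1 — ⋯ — (n-3)`
with the two extra vertices `n-2` and `n-1` both attached to the vertex `n-3`. -/
def cartanD (n : ℕ) : Matrix (Fin n) (Fin n) ℤ :=
  Matrix.of fun i j =>
    if i = j then 2
    else if ((((i : ℕ) + 1 = (j : ℕ) ∨ (j : ℕ) + 1 = (i : ℕ)) ∧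
          ¬ (((i : ℕ) = n - 2 ∧ (j : ℕ) = n - 1) ∨ ((j : ℕ) = n - 2 ∧ (i : ℕ) = n - 1))) ∨
        (((i : ℕ) = n - 3 ∧ (j : ℕ) = n - 1) ∨ ((j : ℕ) = n - 3 ∧ (i : ℕ) = n - 1))) then -1
    else 0

/-- The Cartan matrix of the root lattice `Eₙ` (`n = 6, 7, 8`): a chain `1 — 2 — ⋯ — (n-1)`
with the extra vertex `0` attached to the vertex `3`. -/
def cartanE (n : ℕ) : Matrix (Fin n) (Fin n) ℤ :=
  Matrix.of fun i j =>
    if i = j then 2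
    else if ((((i : ℕ) + 1 = (j : ℕ) ∨ (j : ℕ) + 1 = (i : ℕ)) ∧
          ¬ ((i : ℕ) = 0 ∨ (j : ℕ) = 0)) ∨
        (((i : ℕ) = 0 ∧ (j : ℕ) = 3) ∨ ((j : ℕ) = 0 ∧ (i : ℕ) = 3))) then -1
    else 0

/-- The block-diagonal sum `A ⊕ B` of two square integer matrices. -/
def blockSum {m n : ℕ} (A : Matrix (Fin m) (Fin m) ℤ) (B : Matrix (Fin n) (Fin n) ℤ) :
    Matrix (Fin (m + n)) (Fin (m + n)) ℤ :=
  Matrix.of fun i j =>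
    if hi : (i : ℕ) < m then
      if hj : (j : ℕ) < m then A ⟨i, hi⟩ ⟨j, hj⟩ else 0
    else
      if hj : (j : ℕ) < m then 0
      else B ⟨(i : ℕ) - m, by have := i.isLt; omega⟩ ⟨(j : ℕ) - m, by have := j.isLt; omega⟩

/-- The Gram matrix of the hyperbolic plane `U`. -/
def gramU : Matrix (Fin 2) (Fin 2) ℤ := !![0, 1; 1, 0]

/-- The Gram matrix `G₀` of the even unimodular lattice `U + E₈` of signature `(1,9)`. -/
def gramUE8 : Matrix (Fin 10) (Fin 10) ℤ := blockSum gramU (-(cartanE 8))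

/-- A matrix of the form `T + Tᵀ` represents only even integers. -/
theorem two_dvd_dotProduct_add_transpose_mulVec {n : Type*} [Fintype n]
    (T : Matrix n n ℤ) (v : n → ℤ) : 2 ∣ v ⬝ᵥ (T + Tᵀ) *ᵥ v := by
  refine ⟨v ⬝ᵥ T *ᵥ v, ?_⟩
  rw [add_mulVec, dotProduct_add, mulVec_transpose, dotProduct_comm v (v ᵥ* T),
    ← dotProduct_mulVec, two_mul]

theorem two_dvd_dotProduct_gramUE8_mulVec (v : Fin 10 → ℤ) : 2 ∣ v ⬝ᵥ gramUE8 *ᵥ v := by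
  have h : gramUE8 = of (fun i j => if i < j then gramUE8 i j else if i = j then
      gramUE8 i i / 2 else 0) + (of (fun i j => if i < j then gramUE8 i j else if i = j then
      gramUE8 i i / 2 else 0))ᵀ := by
    decide +kernel
  rw [h]
  exact two_dvd_dotProduct_add_transpose_mulVec _ v

theorem isUnit_gramUE8 : IsUnit gramUE8 := by
  refine IsUnit.of_mul_eq_one !![0, 1, 0, 0, 0, 0, 0, 0, 0, 0;
    1, 0, 0, 0, 0, 0, 0, 0, 0, 0;
    0, 0, -8, -5, -10, -15, -12, -9, -6, -3;
    0, 0, -5, -4, -7, -10, -8, -6, -4, -2;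
    0, 0, -10, -7, -14, -20, -16, -12, -8, -4;
    0, 0, -15, -10, -20, -30, -24, -18, -12, -6;
    0, 0, -12, -8, -16, -24, -20, -15, -10, -5;
    0, 0, -9, -6, -12, -18, -15, -12, -8, -4;
    0, 0, -6, -4, -8, -12, -10, -8, -6, -3;
    0, 0, -3, -2, -4, -6, -5, -4, -3, -2] ?_
  decide +kernel

theorem blockSum_one_add_apply {n : ℕ} (d : ℤ) (B : Matrix (Fin n) (Fin n) ℤ)
    (i j : Fin n) (hi : 1 + (i : ℕ) < 1 + n) (hj : 1 + (j : ℕ) < 1 + n) :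
    blockSum !![d] B ⟨1 + i, hi⟩ ⟨1 + j, hj⟩ = B i j := by
  simp [blockSum]

/-- The Cartan matrix of `D₄ ⊕ A₄ ⊕ A₁`. -/
def cartanD4A4A1 : Matrix (Fin 9) (Fin 9) ℤ :=
  blockSum (cartanD 4) (blockSum (cartanA 4) (cartanA 1))

theorem cartanD4A4A1_eq : cartanD4A4A1 =
    !![2, -1, 0, 0, 0, 0, 0, 0, 0;
      -1, 2, -1, -1, 0, 0, 0, 0, 0;
      0, -1, 2, 0, 0, 0, 0, 0, 0;
      0, -1, 0, 2, 0, 0, 0, 0, 0;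
      0, 0, 0, 0, 2, -1, 0, 0, 0;
      0, 0, 0, 0, -1, 2, -1, 0, 0;
      0, 0, 0, 0, 0, -1, 2, -1, 0;
      0, 0, 0, 0, 0, 0, -1, 2, 0;
      0, 0, 0, 0, 0, 0, 0, 0, 2] := by
  decide +kernel

theorem two_dvd_of_four_dvd_sum_sq {x y z w : ℤ} (hlin : 2 ∣ x + y + z)
    (hsq : 4 ∣ x ^ 2 + y ^ 2 + z ^ 2 + w ^ 2) : 2 ∣ x ∧ 2 ∣ y ∧ 2 ∣ z ∧ 2 ∣ w := by
  obtain ⟨a, rfl | rfl⟩ := x.even_or_odd' <;> obtain ⟨b, rfl | rfl⟩ := y.even_or_odd' <;>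
  obtain ⟨c, rfl | rfl⟩ := z.even_or_odd' <;> obtain ⟨d, rfl | rfl⟩ := w.even_or_odd' <;>
  ring_nf at hsq <;> omega

/-- The discriminant form of `D₄ ⊕ A₄ ⊕ A₁` has no nonzero isotropic element of order two. -/
theorem two_dvd_of_cartanD4A4A1 (c : Fin 9 → ℤ) (hlin : ∀ i, 2 ∣ (cartanD4A4A1 *ᵥ c) i)
    (hquad : 8 ∣ c ⬝ᵥ cartanD4A4A1 *ᵥ c) (i : Fin 9) : 2 ∣ c i := by
  have h0 := hlin 0
  have h1 := hlin 1
  have h4 := hlin 4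
  have h5 := hlin 5
  have h6 := hlin 6
  have h7 := hlin 7
  simp [cartanD4A4A1_eq, mulVec, dotProduct, Fin.sum_univ_succ] at h0 h1 h4 h5 h6 h7 hquad
  obtain ⟨k1, e1⟩ : 2 ∣ c 1 := by omega
  obtain ⟨k4, e4⟩ : 2 ∣ c 4 := by omega
  obtain ⟨k5, e5⟩ : 2 ∣ c 5 := by omega
  obtain ⟨k6, e6⟩ : 2 ∣ c 6 := by omega
  obtain ⟨k7, e7⟩ : 2 ∣ c 7 := by omega
  obtain ⟨m, em⟩ : 2 ∣ c 0 + c 2 + c 3 := by omega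
  obtain ⟨q, hq⟩ := hquad
  have hsq : 4 ∣ c 0 ^ 2 + c 2 ^ 2 + c 3 ^ 2 + c 8 ^ 2 := by
    rw [e1, e4, e5, e6, e7] at hq
    refine ⟨q - k1 ^ 2 + k1 * m - k4 ^ 2 - k5 ^ 2 - k6 ^ 2 - k7 ^ 2 + k4 * k5 + k5 * k6 + k6 * k7,
      mul_left_cancel₀ two_ne_zero ?_⟩
    linear_combination hq + 4 * k1 * em
  obtain ⟨h0, h2, h3, h8⟩ := two_dvd_of_four_dvd_sum_sq ⟨m, em⟩ hsq
  fin_cases i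
  exacts [h0, ⟨k1, e1⟩, h2, h3, ⟨k4, e4⟩, ⟨k5, e5⟩, ⟨k6, e6⟩, ⟨k7, e7⟩, h8]

/-- If the rows of `N` are independent and span a space of codimension at most one, then their
Gram matrix with respect to a nondegenerate form has corank at most one. -/
theorem not_injective_transpose_mulVec {K m n : Type*} [Field K] [Fintype m] [Fintype n]
    [DecidableEq n] (hcard : Fintype.card n ≤ Fintype.card m + 1) {G : Matrix n n K}
    (hG : IsUnit G) (N : Matrix m n K) (a b : m → K) (ha : (N * G * Nᵀ) *ᵥ a = 0)
    (hb : (N * G * Nᵀ) *ᵥ b = 0) (hab : LinearIndependent K ![a, b]) :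
    ¬ Function.Injective Nᵀ.mulVec := by
  intro hN
  have hrank : (N * G).rank = Fintype.card m := by
    rw [rank_mul_eq_left_of_isUnit_det _ _ ((isUnit_iff_isUnit_det _).1 hG), ← rank_transpose,
      Matrix.rank, LinearMap.finrank_range_of_inj hN, Module.finrank_fintype_fun_eq_card]
  have hker := (N * G).mulVecLin.finrank_range_add_finrank_ker
  rw [← Matrix.rank, hrank, Module.finrank_fintype_fun_eq_card] at hker
  have hind := hab.map' Nᵀ.mulVecLin (LinearMap.ker_eq_bot.2 hN)
  have hspan : Submodule.span K (Set.range (Nᵀ.mulVecLin ∘ ![a, b])) ≤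
      (N * G).mulVecLin.ker := by
    rw [Submodule.span_le]
    rintro _ ⟨i, rfl⟩
    rw [SetLike.mem_coe, LinearMap.mem_ker, Function.comp_apply, mulVecLin_apply,
      mulVecLin_apply, mulVec_mulVec]
    revert i
    exact Fin.forall_fin_two.2 ⟨ha, hb⟩
  have hle := Submodule.finrank_mono hspan
  rw [finrank_span_eq_card hind, Fintype.card_fin] at hle
  omega

/-- The lattice `D₄ ⊕ A₄ ⊕ A₁`, with negative definite form, does not embed in `U + E₈`. -/
theorem gram_rows_ne_neg_cartanD4A4A1 (N : Matrix (Fin 9) (Fin 10) ℤ) :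
    N * gramUE8 * Nᵀ ≠ -cartanD4A4A1 := by
  intro hN
  have hinj : Function.Injective (N.map (Int.castRingHom (ZMod 2)))ᵀ.mulVec := by
    rw [← coe_mulVecLin, ← LinearMap.ker_eq_bot, LinearMap.ker_eq_bot']
    intro x hx
    obtain ⟨c, rfl⟩ : ∃ c : Fin 9 → ℤ, (fun i => (c i : ZMod 2)) = x :=
      ⟨fun i => (x i).val, by ext i; simp⟩
    have hdvd : ∀ j, ∃ w, (Nᵀ *ᵥ c) j = 2 * w := by
      intro j
      have := congrFun hx j
      rw [mulVecLin_apply, ← transpose_map] at this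
      have h2 := RingHom.map_mulVec (Int.castRingHom (ZMod 2)) Nᵀ c j
      exact (ZMod.intCast_zmod_eq_zero_iff_dvd _ 2).1 (h2.trans this)
    choose v hv using hdvd
    have hv : Nᵀ *ᵥ c = (2 : ℤ) • v := funext hv
    have hC : cartanD4A4A1 *ᵥ c = (2 : ℤ) • -(N *ᵥ gramUE8 *ᵥ v) := by
      rw [← neg_neg cartanD4A4A1, ← hN, neg_mulVec, ← mulVec_mulVec, hv, mulVec_smul,
        ← mulVec_mulVec, smul_neg]
    ext i
    refine (ZMod.intCast_zmod_eq_zero_iff_dvd _ 2).2 (two_dvd_of_cartanD4A4A1 c ?_ ?_ i)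
    · intro i
      rw [hC]
      exact ⟨_, rfl⟩
    · obtain ⟨w, hw⟩ := two_dvd_dotProduct_gramUE8_mulVec v
      refine ⟨-w, ?_⟩
      rw [hC, dotProduct_smul, dotProduct_neg, dotProduct_mulVec, ← mulVec_transpose, hv,
        smul_dotProduct, hw]
      simp only [smul_eq_mul]
      ring
  have hG : IsUnit (gramUE8.map (Int.castRingHom (ZMod 2))) :=
    isUnit_gramUE8.map (Int.castRingHom (ZMod 2)).mapMatrix
  have hgram : N.map (Int.castRingHom (ZMod 2)) * gramUE8.map (Int.castRingHom (ZMod 2)) *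
      (N.map (Int.castRingHom (ZMod 2)))ᵀ = (-cartanD4A4A1).map (Int.castRingHom (ZMod 2)) := by
    rw [← hN, Matrix.map_mul, Matrix.map_mul, transpose_map]
  refine not_injective_transpose_mulVec (by simp) hG _ ![1, 0, 1, 0, 0, 0, 0, 0, 0]
    ![0, 0, 0, 0, 0, 0, 0, 0, 1] ?_ ?_ ?_ hinj
  · rw [hgram, cartanD4A4A1_eq]
    decide +kernel
  · rw [hgram, cartanD4A4A1_eq]
    decide +kernel
  · rw [LinearIndependent.pair_iff]
    intro s t h
    exact ⟨by simpa using congrFun h 0, by simpa using congrFun h 8⟩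

/-- The root type `D₄ + A₄ + A₁` does not admit a finite-index embedding
`ℤH ⊥ (D₄ + A₄ + A₁) ↪ U + E₈` for any value `d = H²`. -/
theorem no_finite_index_embedding_D4_A4_A1 :
    ¬ ∃ (d : ℤ) (M : Matrix (Fin 10) (Fin 10) ℤ),
      M.det ≠ 0 ∧
      M * gramUE8 * M.transpose =
        blockSum !![d] (-(blockSum (cartanD 4) (blockSum (cartanA 4) (cartanA 1)))) := by
  rintro ⟨d, M, -, hM⟩
  refine gram_rows_ne_neg_cartanD4A4A1 (M.submatrix (Fin.natAdd 1) id) ?_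
  ext i j
  have hij := congrFun (congrFun hM (Fin.natAdd 1 i)) (Fin.natAdd 1 j)
  exact hij.trans (blockSum_one_add_apply d _ i j _ _)
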